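/- arXiv:1706.02019 — 5 statements merged into one kernel-verified Lean document; each statement's English description precedes it below -/
import Mathlib

section
/- Let σ be a non-delay feasible schedule of an open shop instance with delivery times, let u be a job and i a machine with p i u > 0. Then every time t with 0 ≤ t < s i u at which machine i is idle (i.e., t ∉ [s i j, s i j + p i j) for every job j with p i j > 0) belongs to the union over machines i' ≠ i with p i' u > 0 of the intervals [s i' u, s i' u + p i' u); consequently the Lebesgue measure of the set of such idle instants is at most ∑_{i' ≠ i} p i' u. -/
/-- A feasible (non-preemptive) open shop schedule. -/
def OpenShopFeasible (m n : ℕ) (p s : Fin m → Fin n → ℝ) : Prop :=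
  (∀ i j, 0 ≤ s i j) ∧
  (∀ i : Fin m, ∀ j j' : Fin n, j ≠ j' → 0 < p i j → 0 < p i j' →
    Disjoint (Set.Ico (s i j) (s i j + p i j)) (Set.Ico (s i j') (s i j' + p i j'))) ∧
  (∀ j : Fin n, ∀ i i' : Fin m, i ≠ i' → 0 < p i j → 0 < p i' j →
    Disjoint (Set.Ico (s i j) (s i j + p i j)) (Set.Ico (s i' j) (s i' j + p i' j)))

/-- A non-delay (list) schedule: there is no machine `i`, job `j` with `p i j > 0`
and time `0 ≤ t < s i j` such that machine `i` is idle at `t` while job `j` is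
not in process at `t`. -/
def OpenShopNonDelay (m n : ℕ) (p s : Fin m → Fin n → ℝ) : Prop :=
  ¬ ∃ (i : Fin m) (j : Fin n) (t : ℝ), 0 < p i j ∧ 0 ≤ t ∧ t < s i j ∧
      (∀ j' : Fin n, 0 < p i j' → t ∉ Set.Ico (s i j') (s i j' + p i j')) ∧
      (∀ i' : Fin m, 0 < p i' j → t ∉ Set.Ico (s i' j) (s i' j + p i' j))

/-- In a non-delay schedule, every idle instant of machine `i` before the start of
job `u` on machine `i` lies in the union of the operation intervals of `u` on the
other machines; consequently the measure of the set of such idle instants is at most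
`∑_{i' ≠ i} p i' u`. -/
theorem idle_instants_covered (m n : ℕ) (hm : 0 < m) (hn : 0 < n)
    (p : Fin m → Fin n → ℝ) (q : Fin n → ℝ)
    (hp : ∀ i j, 0 ≤ p i j) (hq : ∀ j, 0 ≤ q j)
    (s : Fin m → Fin n → ℝ)
    (hs : OpenShopFeasible m n p s) (hnd : OpenShopNonDelay m n p s)
    (u : Fin n) (i : Fin m) (hpu : 0 < p i u) :
    (∀ t : ℝ, 0 ≤ t → t < s i u →
      (∀ j : Fin n, 0 < p i j → t ∉ Set.Ico (s i j) (s i j + p i j)) →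
      t ∈ ⋃ i' ∈ {i' : Fin m | i' ≠ i ∧ 0 < p i' u}, Set.Ico (s i' u) (s i' u + p i' u)) ∧
    MeasureTheory.volume
        {t : ℝ | 0 ≤ t ∧ t < s i u ∧
          ∀ j : Fin n, 0 < p i j → t ∉ Set.Ico (s i j) (s i j + p i j)} ≤
      ENNReal.ofReal (∑ i' ∈ Finset.univ.erase i, p i' u) := by
  have cover : ∀ t : ℝ, 0 ≤ t → t < s i u →
      (∀ j : Fin n, 0 < p i j → t ∉ Set.Ico (s i j) (s i j + p i j)) →
      t ∈ ⋃ i' ∈ {i' : Fin m | i' ≠ i ∧ 0 < p i' u},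
        Set.Ico (s i' u) (s i' u + p i' u) := by
    intro t ht htu hidle
    by_contra hnot
    refine hnd ⟨i, u, t, hpu, ht, htu, hidle, fun i' hi' hmem => hnot ?_⟩
    have hne : i' ≠ i := by
      rintro rfl
      exact hidle u hpu hmem
    exact Set.mem_biUnion (show i' ∈ {i' : Fin m | i' ≠ i ∧ 0 < p i' u} from ⟨hne, hi'⟩) hmem
  refine ⟨cover, ?_⟩
  calc
    _ ≤ MeasureTheory.volume
        (⋃ i' ∈ Finset.univ.erase i, Set.Ico (s i' u) (s i' u + p i' u)) := by
      refine MeasureTheory.measure_mono fun t ⟨ht, htu, hidle⟩ => ?_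
      obtain ⟨i', hi', hmem⟩ := Set.mem_iUnion₂.1 (cover t ht htu hidle)
      exact Set.mem_iUnion₂.2
        ⟨i', Finset.mem_erase.2 ⟨hi'.1, Finset.mem_univ i'⟩, hmem⟩
    _ ≤ ∑ i' ∈ Finset.univ.erase i,
        MeasureTheory.volume (Set.Ico (s i' u) (s i' u + p i' u)) :=
      MeasureTheory.measure_biUnion_finset_le _ _
    _ = ENNReal.ofReal (∑ i' ∈ Finset.univ.erase i, p i' u) := by
      rw [ENNReal.ofReal_sum_of_nonneg fun i' _ => hp i' u]
      simp only [Real.volume_Ico, add_sub_cancel_left]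
end

section
/- For the two-machine three-job instance above, there exists a feasible schedule with maximum lateness exactly a + 2, and every feasible schedule has maximum lateness at least a + 2; hence the optimal maximum lateness of this instance equals a + 2. -/
/-- The maximum lateness of a schedule. -/
noncomputable def OpenShopLmax (m n : ℕ) (p s : Fin m → Fin n → ℝ) (q : Fin n → ℝ) : ℝ :=
  ⨆ j : Fin n, ((⨆ i : Fin m, (s i j + p i j)) + q j)

/-- The lateness of each operation is at most the maximum lateness. -/
theorem add_le_openShopLmax {m n : ℕ} (p s : Fin m → Fin n → ℝ) (q : Fin n → ℝ)
    (i : Fin m) (j : Fin n) : s i j + p i j + q j ≤ OpenShopLmax m n p s q := by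
  have hC : s i j + p i j ≤ ⨆ i : Fin m, (s i j + p i j) :=
    le_ciSup (f := fun i => s i j + p i j) (Set.finite_range _).bddAbove i
  have hL : (⨆ i : Fin m, (s i j + p i j)) + q j ≤ OpenShopLmax m n p s q :=
    le_ciSup (f := fun j => (⨆ i : Fin m, (s i j + p i j)) + q j) (Set.finite_range _).bddAbove j
  linarith

/-- The maximum lateness is bounded by any common bound on the operations' latenesses. -/
theorem openShopLmax_le {m n : ℕ} [NeZero m] [NeZero n] {p s : Fin m → Fin n → ℝ}
    {q : Fin n → ℝ} {L : ℝ} (h : ∀ i j, s i j + p i j + q j ≤ L) :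
    OpenShopLmax m n p s q ≤ L :=
  ciSup_le fun j => le_sub_iff_add_le.1 <| ciSup_le fun i => le_sub_iff_add_le.2 (h i j)

/-- A job cannot be processed on two machines at once, so its lateness is at least the total
length of any two of its operations plus its delivery time. -/
theorem OpenShopFeasible.add_add_le_lmax {m n : ℕ} {p s : Fin m → Fin n → ℝ}
    (hs : OpenShopFeasible m n p s) (q : Fin n → ℝ) {i i' : Fin m} (hi : i ≠ i') (j : Fin n)
    (hp : 0 < p i j) (hp' : 0 < p i' j) :
    p i j + p i' j + q j ≤ OpenShopLmax m n p s q := by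
  have hd := hs.2.2 j i i' hi hp hp'
  rw [Set.Ico_disjoint_Ico, min_le_iff, le_max_iff, le_max_iff] at hd
  have h0 := hs.1 i j
  have h0' := hs.1 i' j
  have hL := add_le_openShopLmax p s q i j
  have hL' := add_le_openShopLmax p s q i' j
  rcases hd with (h | h) | (h | h) <;> linarith

/-- For the instance with `p 1 1 = a`, `p 2 2 = a`, `p 1 3 = p 2 3 = 1` (other
processing times zero) and delivery times `q 1 = q 2 = 0`, `q 3 = a`, there is a
feasible schedule of maximum lateness exactly `a + 2`, and every feasible schedule
has maximum lateness at least `a + 2`; hence the optimum equals `a + 2`. -/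
theorem hard_instance_optimum (a : ℝ) (ha : 1 ≤ a) :
    (∃ s : Fin 2 → Fin 3 → ℝ,
        OpenShopFeasible 2 3 ![![a, 0, 1], ![0, a, 1]] s ∧
        OpenShopLmax 2 3 ![![a, 0, 1], ![0, a, 1]] s ![0, 0, a] = a + 2) ∧
    (∀ s : Fin 2 → Fin 3 → ℝ,
        OpenShopFeasible 2 3 ![![a, 0, 1], ![0, a, 1]] s →
        a + 2 ≤ OpenShopLmax 2 3 ![![a, 0, 1], ![0, a, 1]] s ![0, 0, a]) := by
  have lower : ∀ s : Fin 2 → Fin 3 → ℝ,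
      OpenShopFeasible 2 3 ![![a, 0, 1], ![0, a, 1]] s →
      a + 2 ≤ OpenShopLmax 2 3 ![![a, 0, 1], ![0, a, 1]] s ![0, 0, a] := by
    intro s hs
    have h := hs.add_add_le_lmax ![0, 0, a] (i := 0) (i' := 1) (by decide) 2 (by simp) (by simp)
    have hsum : (![![a, 0, 1], ![0, a, 1]] : Fin 2 → Fin 3 → ℝ) 0 2 +
        (![![a, 0, 1], ![0, a, 1]] : Fin 2 → Fin 3 → ℝ) 1 2 +
        (![0, 0, a] : Fin 3 → ℝ) 2 = a + 2 := by
      simp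
      ring
    exact hsum.symm.le.trans h
  have feasible : OpenShopFeasible 2 3 ![![a, 0, 1], ![0, a, 1]] ![![1, 0, 0], ![0, 2, 1]] := by
    refine ⟨?_, ?_, ?_⟩
    · intro i j
      fin_cases i <;> fin_cases j <;> simp
    · intro i j j' hj hp hp'
      rw [Set.Ico_disjoint_Ico, min_le_iff, le_max_iff, le_max_iff]
      fin_cases i <;> fin_cases j <;> fin_cases j' <;> simp at hj hp hp' ⊢ <;> norm_num
    · intro j i i' hi hp hp'
      rw [Set.Ico_disjoint_Ico, min_le_iff, le_max_iff, le_max_iff]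
      fin_cases j <;> fin_cases i <;> fin_cases i' <;> simp at hi hp hp' ⊢
  refine ⟨⟨_, feasible, le_antisymm (openShopLmax_le fun i j => ?_) (lower _ feasible)⟩, lower⟩
  fin_cases i <;> fin_cases j <;> simp <;> linarith
end

section
/- (Proposition 3, first part) There exists an integer k with 1 ≤ k ≤ ⌈m/ε⌉ such that p(S_k) ≤ ε · P. -/
/-- The set of small jobs of rank `k`: jobs whose largest operation duration lies in
`[ε̄^{k+1}·P, ε̄^k·P)`, where `P = max_i ∑_j p i j` and the largest operation of job
`j` is `max_i p i j`. -/
noncomputable def smallJobs (m n : ℕ) (p : Fin m → Fin n → ℝ) (εbar : ℝ) (k : ℕ) :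
    Finset (Fin n) :=
  Finset.univ.filter fun j =>
    εbar ^ (k + 1) * (⨆ i : Fin m, ∑ j' : Fin n, p i j') ≤ (⨆ i : Fin m, p i j) ∧
    (⨆ i : Fin m, p i j) < εbar ^ k * (⨆ i : Fin m, ∑ j' : Fin n, p i j')

theorem pairwise_disjoint_smallJobs {m n : ℕ} {p : Fin m → Fin n → ℝ} {εbar : ℝ}
    (h0 : 0 ≤ εbar) (h1 : εbar ≤ 1) (hP : 0 ≤ ⨆ i : Fin m, ∑ j : Fin n, p i j) :
    Pairwise (Function.onFun Disjoint (smallJobs m n p εbar)) := by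
  refine (pairwise_disjoint_on _).2 fun k l hkl => Finset.disjoint_left.2 fun j hk hl => ?_
  simp only [smallJobs, Finset.mem_filter] at hk hl
  have hpow : εbar ^ l ≤ εbar ^ (k + 1) := pow_le_pow_of_le_one h0 h1 hkl
  exact absurd (hl.2.2.trans_le (mul_le_mul_of_nonneg_right hpow hP)) hk.2.1.not_gt

theorem sum_sum_le_card_mul_iSup (m n : ℕ) (p : Fin m → Fin n → ℝ) :
    ∑ j : Fin n, ∑ i : Fin m, p i j ≤ m * ⨆ i : Fin m, ∑ j : Fin n, p i j := by
  rw [Finset.sum_comm]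
  simpa using Finset.sum_le_card_nsmul Finset.univ (fun i => ∑ j, p i j) _
    fun i _ => le_ciSup (Set.finite_range fun i => ∑ j, p i j).bddAbove i

/-- Proposition 3 (first part): there exists an integer `k` with `1 ≤ k ≤ ⌈m/ε⌉`
such that `p(S_k) ≤ ε · P`, where `ε̄ = ε/(2m(m+1))`. -/
theorem exists_good_k (m n : ℕ) (hm : 0 < m) (hn : 0 < n)
    (p : Fin m → Fin n → ℝ) (hp : ∀ i j, 0 ≤ p i j)
    (ε : ℝ) (hε0 : 0 < ε) (hε1 : ε ≤ 1) :
    ∃ k : ℕ, 1 ≤ k ∧ k ≤ ⌈(m : ℝ) / ε⌉₊ ∧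
      ∑ j ∈ smallJobs m n p (ε / (2 * m * (m + 1))) k, ∑ i : Fin m, p i j ≤
        ε * (⨆ i : Fin m, ∑ j : Fin n, p i j) := by
  have hm1 : (1 : ℝ) ≤ m := by exact_mod_cast hm
  have hP : 0 ≤ ⨆ i : Fin m, ∑ j : Fin n, p i j :=
    Real.iSup_nonneg fun i => Finset.sum_nonneg fun j _ => hp i j
  have hdisj := pairwise_disjoint_smallJobs (p := p) (εbar := ε / (2 * m * (m + 1)))
    (by positivity) (div_le_one_of_le₀ (by nlinarith) (by positivity)) hP
  by_contra! hlarge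
  have hK : 1 ≤ ⌈(m : ℝ) / ε⌉₊ := Nat.one_le_ceil_iff.2 (by positivity)
  have hlt := Finset.sum_lt_sum_of_nonempty (Finset.nonempty_Icc.2 hK)
    fun k hk => hlarge k (Finset.mem_Icc.1 hk).1 (Finset.mem_Icc.1 hk).2
  rw [← Finset.sum_biUnion fun k _ l _ hkl => hdisj hkl, Finset.sum_const, Nat.card_Icc,
    Nat.add_sub_cancel, nsmul_eq_mul] at hlt
  have hle := Finset.sum_le_univ_sum_of_nonneg (f := fun j => ∑ i, p i j)
    (s := (Finset.Icc 1 ⌈(m : ℝ) / ε⌉₊).biUnion (smallJobs m n p (ε / (2 * m * (m + 1)))))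
    fun j => Finset.sum_nonneg fun i _ => hp i j
  have hceil : (m : ℝ) ≤ ⌈(m : ℝ) / ε⌉₊ * ε := (div_le_iff₀ hε0).1 (Nat.le_ceil _)
  have hmul := mul_le_mul_of_nonneg_right hceil hP
  have htotal := sum_sum_le_card_mul_iSup m n p
  linarith
end

section
/- (Proposition 3, second part) If P > 0, then for every integer k ≥ 0 the number of big jobs satisfies |B_k| ≤ m / ε̄^k. -/
/-- The set of big jobs of rank `k`: jobs whose largest operation duration is at least
`ε̄^k·P`, where `P = max_i ∑_j p i j` and the largest operation of job `j` is
`max_i p i j`. -/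
noncomputable def bigJobs (m n : ℕ) (p : Fin m → Fin n → ℝ) (εbar : ℝ) (k : ℕ) :
    Finset (Fin n) :=
  Finset.univ.filter fun j =>
    εbar ^ k * (⨆ i : Fin m, ∑ j' : Fin n, p i j') ≤ (⨆ i : Fin m, p i j)

/-- The big jobs, each counted with weight `ε̄^k·P`, weigh at most the total processing time,
hence at most `m·P`. -/
theorem bigJobs_card_mul_le (m n : ℕ) (hm : 0 < m) (p : Fin m → Fin n → ℝ)
    (hp : ∀ i j, 0 ≤ p i j) (εbar : ℝ) (k : ℕ) :
    ((bigJobs m n p εbar k).card : ℝ) * (εbar ^ k * ⨆ i : Fin m, ∑ j : Fin n, p i j) ≤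
      m * ⨆ i : Fin m, ∑ j : Fin n, p i j := by
  have : Nonempty (Fin m) := ⟨⟨0, hm⟩⟩
  have max_le_sum (j : Fin n) : (⨆ i : Fin m, p i j) ≤ ∑ i : Fin m, p i j :=
    ciSup_le fun i =>
      Finset.single_le_sum (f := fun i => p i j) (fun i _ => hp i j) (Finset.mem_univ i)
  calc ((bigJobs m n p εbar k).card : ℝ) * (εbar ^ k * ⨆ i : Fin m, ∑ j : Fin n, p i j)
      = ∑ _j ∈ bigJobs m n p εbar k, εbar ^ k * ⨆ i : Fin m, ∑ j : Fin n, p i j := by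
        rw [Finset.sum_const, nsmul_eq_mul]
    _ ≤ ∑ j ∈ bigJobs m n p εbar k, ∑ i : Fin m, p i j :=
        Finset.sum_le_sum fun j hj => (Finset.mem_filter.mp hj).2.trans (max_le_sum j)
    _ ≤ ∑ j : Fin n, ∑ i : Fin m, p i j :=
        Finset.sum_le_sum_of_subset_of_nonneg (Finset.subset_univ _)
          fun j _ _ => Finset.sum_nonneg fun i _ => hp i j
    _ = ∑ i : Fin m, ∑ j : Fin n, p i j := Finset.sum_comm
    _ ≤ ∑ _i : Fin m, ⨆ i : Fin m, ∑ j : Fin n, p i j :=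
        Finset.sum_le_sum fun i _ =>
          le_ciSup (f := fun i : Fin m => ∑ j : Fin n, p i j) (Set.finite_range _).bddAbove i
    _ = m * ⨆ i : Fin m, ∑ j : Fin n, p i j := by simp

/-- Proposition 3 (second part): if `P > 0`, then for every integer `k ≥ 0` the number
of big jobs satisfies `|B_k| ≤ m / ε̄^k`, where `ε̄ = ε/(2m(m+1))`. -/
theorem bigJobs_card_bound (m n : ℕ) (hm : 0 < m) (hn : 0 < n)
    (p : Fin m → Fin n → ℝ) (hp : ∀ i j, 0 ≤ p i j)
    (ε : ℝ) (hε0 : 0 < ε) (hε1 : ε ≤ 1)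
    (hP : 0 < ⨆ i : Fin m, ∑ j : Fin n, p i j) :
    ∀ k : ℕ, ((bigJobs m n p (ε / (2 * m * (m + 1))) k).card : ℝ) ≤
      m / (ε / (2 * m * (m + 1))) ^ k := by
  intro k
  have hεbar : 0 < ε / (2 * m * (m + 1)) := by positivity
  rw [le_div_iff₀ (pow_pos hεbar k)]
  refine le_of_mul_le_mul_right ?_ hP
  rw [mul_assoc]
  exact bigJobs_card_mul_le m n hm p hp _ k
end

section
/- (Lemma 1, grid alignment) Let σ with start times s i j be a feasible schedule of an open shop instance on m machines and n jobs, and let δ > 0. Then there exists a feasible schedule σ̄ of the same instance, with start times s̄ i j, such that: every s̄ i j is an integer multiple of δ; the operations are sequenced in the same order on each machine (for every machine i and jobs j, j' with p i j > 0 and p i j' > 0, s i j < s i j' implies s̄ i j < s̄ i j'); and for every machine i and job j, s i j + 2mδ ≤ s̄ i j ≤ s i j + (2 + n)·m·δ. -/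
/-- The number of operations that start strictly before time `t`. -/
noncomputable def startRank {ι : Type*} [Fintype ι] (s : ι → ℝ) (t : ℝ) : ℕ := by
  classical exact (Finset.univ.filter fun a => s a < t).card

lemma startRank_lt_card {ι : Type*} [Fintype ι] (s : ι → ℝ) (a : ι) :
    startRank s (s a) < Fintype.card ι := by
  classical
  unfold startRank
  exact Finset.card_lt_univ_of_notMem (x := a) (by simp)

lemma startRank_lt_startRank {ι : Type*} [Fintype ι] (s : ι → ℝ) {a : ι} {t : ℝ}
    (h : s a < t) : startRank s (s a) < startRank s t := by
  classical
  unfold startRank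
  refine Finset.card_lt_card (Finset.ssubset_iff_of_subset ?_ |>.2 ⟨a, by simpa using h, by simp⟩)
  intro b hb
  simp only [Finset.mem_filter, Finset.mem_univ, true_and] at hb ⊢
  exact hb.trans h

lemma disjoint_Ico_add_iff {a b x y : ℝ} (hx : 0 < x) (hy : 0 < y) :
    Disjoint (Set.Ico a (a + x)) (Set.Ico b (b + y)) ↔ a + x ≤ b ∨ b + y ≤ a := by
  rw [Set.Ico_disjoint_Ico, min_le_iff, le_max_iff, le_max_iff]
  grind

/-- The operation preceded by `k` others is delayed by `k * δ + c * δ` and rounded up to the grid. -/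
noncomputable def gridStart {ι : Type*} [Fintype ι] (s : ι → ℝ) (δ c : ℝ) (a : ι) : ℝ :=
  ⌈s a / δ + startRank s (s a) + c⌉ * δ

lemma le_gridStart {ι : Type*} [Fintype ι] (s : ι → ℝ) {δ : ℝ} (hδ : 0 < δ) (c : ℝ) (a : ι) :
    s a + (startRank s (s a) + c) * δ ≤ gridStart s δ c a := by
  have h := mul_le_mul_of_nonneg_right (Int.le_ceil (s a / δ + startRank s (s a) + c)) hδ.le
  have e : (s a / δ + startRank s (s a) + c) * δ = s a + (startRank s (s a) + c) * δ := by
    field_simp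
    ring
  rwa [e] at h

lemma gridStart_lt {ι : Type*} [Fintype ι] (s : ι → ℝ) {δ : ℝ} (hδ : 0 < δ) (c : ℝ) (a : ι) :
    gridStart s δ c a < s a + (startRank s (s a) + 1 + c) * δ := by
  have h := mul_lt_mul_of_pos_right (Int.ceil_lt_add_one (s a / δ + startRank s (s a) + c)) hδ
  have e : (s a / δ + startRank s (s a) + c + 1) * δ
      = s a + (startRank s (s a) + 1 + c) * δ := by
    field_simp
    ring
  rwa [e] at h

/-- Aligning to the grid never decreases the distance between two start times. -/
lemma gridStart_add_lt {ι : Type*} [Fintype ι] (s : ι → ℝ) {δ : ℝ} (hδ : 0 < δ) (c : ℝ)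
    {a b : ι} (h : s a < s b) :
    gridStart s δ c a + (s b - s a) < gridStart s δ c b := by
  have h1 := le_gridStart s hδ c b
  have h2 := gridStart_lt s hδ c a
  have h3 : (startRank s (s a) : ℝ) + 1 ≤ startRank s (s b) :=
    mod_cast startRank_lt_startRank s h
  have h4 := mul_le_mul_of_nonneg_right h3 hδ.le
  linarith

lemma disjoint_gridStart {ι : Type*} [Fintype ι] (s : ι → ℝ) {δ : ℝ} (hδ : 0 < δ) (c : ℝ)
    {a b : ι} {x y : ℝ} (hx : 0 < x) (hy : 0 < y)
    (h : Disjoint (Set.Ico (s a) (s a + x)) (Set.Ico (s b) (s b + y))) :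
    Disjoint (Set.Ico (gridStart s δ c a) (gridStart s δ c a + x))
      (Set.Ico (gridStart s δ c b) (gridStart s δ c b + y)) := by
  rw [disjoint_Ico_add_iff hx hy] at h ⊢
  rcases h with h | h
  · have := gridStart_add_lt s hδ c (a := a) (b := b) (by linarith)
    left; linarith
  · have := gridStart_add_lt s hδ c (a := b) (b := a) (by linarith)
    right; linarith

/-- Lemma 1 (grid alignment): for every feasible schedule `s` and every `δ > 0` there
is a feasible schedule `s̄` of the same instance whose start times are integer
multiples of `δ`, which sequences the operations on each machine in the same order,
and which satisfies `s i j + 2mδ ≤ s̄ i j ≤ s i j + (2 + n)·m·δ` for all `i`, `j`. -/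
theorem grid_alignment (m n : ℕ) (hm : 0 < m) (hn : 0 < n)
    (p : Fin m → Fin n → ℝ) (hp : ∀ i j, 0 ≤ p i j)
    (s : Fin m → Fin n → ℝ) (hs : OpenShopFeasible m n p s)
    (δ : ℝ) (hδ : 0 < δ) :
    ∃ sbar : Fin m → Fin n → ℝ,
      OpenShopFeasible m n p sbar ∧
      (∀ i j, ∃ z : ℤ, sbar i j = z * δ) ∧
      (∀ i : Fin m, ∀ j j' : Fin n, 0 < p i j → 0 < p i j' →
        s i j < s i j' → sbar i j < sbar i j') ∧
      (∀ i j, s i j + 2 * m * δ ≤ sbar i j ∧ sbar i j ≤ s i j + (2 + n) * m * δ) := by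
  let f : Fin m × Fin n → ℝ := fun a => s a.1 a.2
  have lower : ∀ i j, s i j + 2 * m * δ ≤ gridStart f δ (2 * m) (i, j) := fun i j => by
    have h := le_gridStart f hδ (2 * m) (i, j)
    have h' : 0 ≤ (startRank f (f (i, j)) : ℝ) * δ := by positivity
    change s i j + _ ≤ _ at h
    linarith
  refine ⟨fun i j => gridStart f δ (2 * m) (i, j), ⟨fun i j => ?_, ?_, ?_⟩, ?_, ?_, ?_⟩
  · have h : 0 ≤ 2 * (m : ℝ) * δ := by positivity
    linarith [lower i j, hs.1 i j]
  · exact fun i j j' hj h h' => disjoint_gridStart f hδ _ h h' (hs.2.1 i j j' hj h h')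
  · exact fun j i i' hi h h' => disjoint_gridStart f hδ _ h h' (hs.2.2 j i i' hi h h')
  · exact fun i j => ⟨_, rfl⟩
  · intro i j j' _ _ h
    have := gridStart_add_lt f hδ (2 * m) (a := (i, j)) (b := (i, j')) h
    change _ + (s i j' - s i j) < _ at this
    linarith
  · refine fun i j => ⟨lower i j, ?_⟩
    have h := gridStart_lt f hδ (2 * m) (i, j)
    have hc : (startRank f (f (i, j)) : ℝ) + 1 ≤ m * n := by
      have := startRank_lt_card f (i, j)
      simp only [Fintype.card_prod, Fintype.card_fin] at this
      exact_mod_cast this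
    have h' := mul_le_mul_of_nonneg_right hc hδ.le
    change _ < s i j + _ at h
    linarith
end
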